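/- Define C^{01}_{j_2 j_1} = ∫_t^T (t−t_2) φ_{j_2}(t_2) ∫_t^{t_2} φ_{j_1}(t_1) dt_1 dt_2 and C_{j_2 j_1} = ∫_t^T φ_{j_2}(y) ∫_t^y φ_{j_1}(x) dx dy. Then C^{01}_{j_2 j_1} = −(Δ/2)·C_{j_2 j_1} − (Δ²/4)·A_{j_2 j_1}, where A_{1,0} = 1/√3; for every integer i ≥ 0: A_{i+2, i} = (i+2)/((2i+3)√((2i+1)(2i+5))), A_{i, i+2} = −(i+1)/((2i+3)√((2i+1)(2i+5))), and A_{i, i} = −1/((2i−1)(2i+3)); and A_{j_2 j_1} = 0 for all other pairs (j_2, j_1). -/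

import Mathlib

open MeasureTheory

/-- The `n`-th Legendre polynomial, given by Rodrigues' formula
`P_n(x) = (1/(2^n n!)) (d/dx)^n (x²−1)^n`. -/
noncomputable def legendreP (n : ℕ) (x : ℝ) : ℝ :=
  (1 / ((2 : ℝ) ^ n * (Nat.factorial n))) * iteratedDeriv n (fun y => (y ^ 2 - 1) ^ n) x

section

open Polynomial

/-- The `n`-th Legendre polynomial as an element of `ℝ[X]`. -/
noncomputable def legendrePoly (n : ℕ) : ℝ[X] :=
  C (1 / ((2 : ℝ) ^ n * (Nat.factorial n))) * derivative^[n] ((X ^ 2 - 1) ^ n)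

theorem iteratedDeriv_polynomial_eval (p : ℝ[X]) (n : ℕ) :
    iteratedDeriv n (fun y => p.eval y) = fun y => (derivative^[n] p).eval y := by
  induction n with
  | zero => simp
  | succ n ih =>
    rw [iteratedDeriv_succ, ih, Function.iterate_succ_apply']
    funext y
    exact Polynomial.deriv _

theorem legendreP_eq_eval (n : ℕ) (x : ℝ) : legendreP n x = (legendrePoly n).eval x := by
  have h : (fun y : ℝ => (y ^ 2 - 1) ^ n) = fun y => ((X ^ 2 - 1 : ℝ[X]) ^ n).eval y := by
    funext y; simp
  rw [legendreP, legendrePoly, h, iteratedDeriv_polynomial_eval]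
  simp

theorem legendrePoly_zero : legendrePoly 0 = 1 := by simp [legendrePoly]

theorem legendrePoly_one : legendrePoly 1 = X := by
  simp [legendrePoly, ← mul_assoc, ← C_mul, one_add_one_eq_two]

theorem derivative_sq_sub_one_pow_succ (n : ℕ) :
    derivative ((X ^ 2 - 1 : ℝ[X]) ^ (n + 1)) =
      C (2 * ((n : ℝ) + 1)) * (X * (X ^ 2 - 1) ^ n) := by
  rw [derivative_pow_succ]
  simp [C_ofNat]
  ring

theorem derivative_legendrePoly_succ (n : ℕ) :
    derivative (legendrePoly (n + 1)) =
      X * derivative (legendrePoly n) + C ((n : ℝ) + 1) * legendrePoly n := by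
  have hU : derivative^[n + 1] (X * (X ^ 2 - 1 : ℝ[X]) ^ n) =
      X * derivative^[n + 1] ((X ^ 2 - 1) ^ n) +
        C ((n : ℝ) + 1) * derivative^[n] ((X ^ 2 - 1) ^ n) := by
    rw [mul_comm X, iterate_derivative_mul_X]
    simp
    ring
  have hc : 1 / ((2 : ℝ) ^ (n + 1) * (Nat.factorial (n + 1))) * (2 * ((n : ℝ) + 1)) =
      1 / ((2 : ℝ) ^ n * (Nat.factorial n)) := by
    rw [Nat.factorial_succ]
    push_cast
    field_simp
    ring
  simp only [legendrePoly, derivative_C_mul, ← Function.iterate_succ_apply' derivative]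
  rw [Function.iterate_succ_apply derivative (n + 1), derivative_sq_sub_one_pow_succ,
    iterate_derivative_C_mul, ← mul_assoc, ← C_mul, hc, hU]
  ring

theorem derivative_legendrePoly_add_two (n : ℕ) :
    derivative (legendrePoly (n + 2)) =
      C (2 * (n : ℝ) + 3) * legendrePoly (n + 1) + derivative (legendrePoly n) := by
  have hD : derivative (derivative ((X ^ 2 - 1 : ℝ[X]) ^ (n + 2))) =
      C (2 * ((n : ℝ) + 2)) * (C (2 * (n : ℝ) + 3) * (X ^ 2 - 1) ^ (n + 1) +
        C (2 * ((n : ℝ) + 1)) * (X ^ 2 - 1) ^ n) := by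
    rw [derivative_sq_sub_one_pow_succ, derivative_C_mul, derivative_mul,
      derivative_sq_sub_one_pow_succ]
    simp [C_ofNat]
    ring
  have hc : 1 / ((2 : ℝ) ^ (n + 2) * (Nat.factorial (n + 2))) * (2 * ((n : ℝ) + 2)) =
      1 / ((2 : ℝ) ^ (n + 1) * (Nat.factorial (n + 1))) := by
    rw [Nat.factorial_succ (n + 1)]
    push_cast
    field_simp
    ring
  have hc' : 1 / ((2 : ℝ) ^ (n + 1) * (Nat.factorial (n + 1))) * (2 * ((n : ℝ) + 1)) =
      1 / ((2 : ℝ) ^ n * (Nat.factorial n)) := by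
    rw [Nat.factorial_succ]
    push_cast
    field_simp
    ring
  simp only [legendrePoly, derivative_C_mul, ← Function.iterate_succ_apply' derivative]
  rw [Function.iterate_succ_apply derivative (n + 2),
    Function.iterate_succ_apply derivative (n + 1), hD, iterate_derivative_C_mul, ← mul_assoc,
    ← C_mul, hc, iterate_map_add, iterate_derivative_C_mul, iterate_derivative_C_mul]
  have hC := congrArg C hc'
  rw [C_mul] at hC
  linear_combination hC * derivative^[n + 1] ((X ^ 2 - 1) ^ n)

theorem X_mul_derivative_legendrePoly (n : ℕ) :
    X * derivative (legendrePoly (n + 1)) =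
      derivative (legendrePoly n) + C ((n : ℝ) + 1) * legendrePoly (n + 1) := by
  have h1 := derivative_legendrePoly_succ (n + 1)
  have h2 := derivative_legendrePoly_add_two n
  simp only [Nat.cast_add, Nat.cast_one, C_add, C_mul, C_1, C_ofNat] at *
  linear_combination h2 - h1

theorem one_sub_X_sq_mul_derivative_legendrePoly (n : ℕ) :
    (1 - X ^ 2) * derivative (legendrePoly (n + 1)) =
      C ((n : ℝ) + 1) * (legendrePoly n - X * legendrePoly (n + 1)) := by
  linear_combination derivative_legendrePoly_succ n - X * X_mul_derivative_legendrePoly n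

theorem eval_one_legendrePoly (n : ℕ) : (legendrePoly n).eval 1 = 1 := by
  induction n with
  | zero => simp [legendrePoly_zero]
  | succ n ih =>
    have h := congrArg (eval 1) (one_sub_X_sq_mul_derivative_legendrePoly n)
    have hn : (n : ℝ) + 1 ≠ 0 := by positivity
    simp [hn, ih] at h
    linarith

theorem eval_neg_one_legendrePoly (n : ℕ) : (legendrePoly n).eval (-1) = (-1) ^ n := by
  induction n with
  | zero => simp [legendrePoly_zero]
  | succ n ih =>
    have h := congrArg (eval (-1)) (one_sub_X_sq_mul_derivative_legendrePoly n)
    have hn : (n : ℝ) + 1 ≠ 0 := by positivity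
    simp [hn, ih] at h
    rw [pow_succ]
    linarith

theorem legendrePoly_recurrence (n : ℕ) :
    C (2 * (n : ℝ) + 1) * (X * legendrePoly n) =
      C ((n : ℝ) + 1) * legendrePoly (n + 1) + C (n : ℝ) * legendrePoly (n - 1) := by
  cases n with
  | zero => simp [legendrePoly_zero, legendrePoly_one]
  | succ n =>
    rw [← sub_eq_zero]
    set R := C (2 * ((n + 1 : ℕ) : ℝ) + 1) * (X * legendrePoly (n + 1)) -
      (C (((n + 1 : ℕ) : ℝ) + 1) * legendrePoly (n + 1 + 1) +
        C ((n + 1 : ℕ) : ℝ) * legendrePoly (n + 1 - 1)) with hR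
    have hd : derivative R = 0 := by
      have h1 := derivative_legendrePoly_succ (n + 1)
      have h2 := X_mul_derivative_legendrePoly n
      simp only [hR, derivative_sub, derivative_add, derivative_mul, derivative_C,
        derivative_X, Nat.add_sub_cancel]
      simp only [Nat.cast_add, Nat.cast_one, C_add, C_mul, C_1, C_ofNat] at *
      linear_combination (-(C (n : ℝ) + 2)) * h1 + (C (n : ℝ) + 1) * h2
    have he : R.eval 1 = 0 := by
      simp [hR, eval_one_legendrePoly]
      ring
    rw [eq_C_of_derivative_eq_zero hd] at he ⊢
    simpa using he

theorem derivative_one_sub_X_sq_mul_derivative_legendrePoly (n : ℕ) :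
    derivative ((1 - X ^ 2) * derivative (legendrePoly n)) =
      -(C ((n : ℝ) * (n + 1)) * legendrePoly n) := by
  cases n with
  | zero => simp [legendrePoly_zero]
  | succ n =>
    have h2 := X_mul_derivative_legendrePoly n
    rw [one_sub_X_sq_mul_derivative_legendrePoly]
    simp only [derivative_sub, derivative_mul, derivative_C, derivative_X]
    simp only [Nat.cast_add, Nat.cast_one, C_add, C_mul, C_1] at *
    linear_combination (-(C (n : ℝ) + 1)) * h2

/-- Integration over `[-1, 1]` as a linear functional on polynomials. -/
noncomputable def integralSymm : ℝ[X] →ₗ[ℝ] ℝ where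
  toFun p := ∫ x in (-1 : ℝ)..1, p.eval x
  map_add' p q := by
    simp only [eval_add]
    exact intervalIntegral.integral_add (p.continuous.intervalIntegrable _ _)
      (q.continuous.intervalIntegrable _ _)
  map_smul' c p := by simp

theorem integralSymm_apply (p : ℝ[X]) : integralSymm p = ∫ x in (-1 : ℝ)..1, p.eval x := rfl

theorem integralSymm_C_mul (c : ℝ) (p : ℝ[X]) : integralSymm (C c * p) = c * integralSymm p := by
  rw [← smul_eq_C_mul, map_smul, smul_eq_mul]

theorem integral_eval_derivative (p : ℝ[X]) (a b : ℝ) :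
    ∫ x in a..b, (derivative p).eval x = p.eval b - p.eval a :=
  intervalIntegral.integral_eq_sub_of_hasDerivAt (fun x _ => p.hasDerivAt x)
    ((derivative p).continuous.intervalIntegrable _ _)

theorem integralSymm_legendrePoly_mul_of_ne {m n : ℕ} (h : m ≠ n) :
    integralSymm (legendrePoly m * legendrePoly n) = 0 := by
  set W := (1 - X ^ 2) * derivative (legendrePoly n) * legendrePoly m -
    (1 - X ^ 2) * derivative (legendrePoly m) * legendrePoly n with hW
  have hd : derivative W =
      C ((m : ℝ) * (m + 1) - n * (n + 1)) * (legendrePoly m * legendrePoly n) := by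
    rw [hW, derivative_sub, derivative_mul, derivative_mul (f := (1 - X ^ 2) * derivative _),
      derivative_one_sub_X_sq_mul_derivative_legendrePoly,
      derivative_one_sub_X_sq_mul_derivative_legendrePoly, C_sub]
    ring
  have hI : integralSymm (derivative W) = 0 := by
    rw [integralSymm_apply, integral_eval_derivative]
    simp [hW]
  rw [hd, integralSymm_C_mul] at hI
  refine (mul_eq_zero.mp hI).resolve_left fun h0 => ?_
  have h1 : ((m : ℝ) - n) * (m + n + 1) = 0 := by linear_combination h0
  have h2 : (m : ℝ) + n + 1 ≠ 0 := by positivity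
  exact h (by exact_mod_cast sub_eq_zero.mp ((mul_eq_zero.mp h1).resolve_right h2))

theorem integralSymm_legendrePoly_mul_self (n : ℕ) :
    integralSymm (legendrePoly n * legendrePoly n) = 2 / (2 * (n : ℝ) + 1) := by
  induction n with
  | zero => simp [legendrePoly_zero, integralSymm_apply]; norm_num
  | succ n ih =>
    have h1 := congrArg (fun p => integralSymm (p * legendrePoly (n + 1)))
      (legendrePoly_recurrence n)
    have h2 := congrArg (fun p => integralSymm (p * legendrePoly n))
      (legendrePoly_recurrence (n + 1))
    simp only [add_mul, mul_assoc, map_add, integralSymm_C_mul, Nat.add_sub_cancel] at h1 h2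
    rw [integralSymm_legendrePoly_mul_of_ne (by omega : n - 1 ≠ n + 1)] at h1
    rw [integralSymm_legendrePoly_mul_of_ne (by omega : n + 1 + 1 ≠ n), ih,
      mul_comm (legendrePoly (n + 1))] at h2
    push_cast at h1 h2 ⊢
    have hn : (n : ℝ) + 1 ≠ 0 := by positivity
    have e1 : (2 * (n : ℝ) + 1) ≠ 0 := by positivity
    have e2 : (2 * ((n : ℝ) + 1) + 1) ≠ 0 := by positivity
    rw [eq_div_iff e2]
    apply mul_left_cancel₀ hn
    field_simp at h2
    linear_combination (-(2 * ((n : ℝ) + 1) + 1)) * h1 + h2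

theorem integralSymm_legendrePoly_mul (m n : ℕ) :
    integralSymm (legendrePoly m * legendrePoly n) =
      if m = n then 2 / (2 * (n : ℝ) + 1) else 0 := by
  split_ifs with h
  · rw [h, integralSymm_legendrePoly_mul_self]
  · exact integralSymm_legendrePoly_mul_of_ne h

/-- The antiderivative of `legendrePoly n` vanishing at `-1`. -/
noncomputable def legendrePolyPrimitive : ℕ → ℝ[X]
  | 0 => legendrePoly 1 + legendrePoly 0
  | n + 1 => C (1 / (2 * (n : ℝ) + 3)) * (legendrePoly (n + 2) - legendrePoly n)

theorem derivative_legendrePolyPrimitive (n : ℕ) :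
    derivative (legendrePolyPrimitive n) = legendrePoly n := by
  cases n with
  | zero => simp [legendrePolyPrimitive, legendrePoly_zero, legendrePoly_one]
  | succ n =>
    have hn : 1 / (2 * (n : ℝ) + 3) * (2 * (n : ℝ) + 3) = 1 := by
      field_simp
    rw [legendrePolyPrimitive, derivative_C_mul, derivative_sub,
      derivative_legendrePoly_add_two, add_sub_cancel_right, ← mul_assoc, ← C_mul, hn, C_1,
      one_mul]

theorem eval_neg_one_legendrePolyPrimitive (n : ℕ) :
    (legendrePolyPrimitive n).eval (-1) = 0 := by
  cases n <;> simp [legendrePolyPrimitive, eval_neg_one_legendrePoly, pow_add]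

theorem integral_eval_legendrePoly (n : ℕ) (y : ℝ) :
    ∫ x in (-1 : ℝ)..y, (legendrePoly n).eval x = (legendrePolyPrimitive n).eval y := by
  rw [← derivative_legendrePolyPrimitive n, integral_eval_derivative,
    eval_neg_one_legendrePolyPrimitive, sub_zero]

theorem integralSymm_X_mul_legendrePoly_mul (m n : ℕ) :
    (2 * (m : ℝ) + 1) * integralSymm (X * legendrePoly m * legendrePoly n) =
      ((m : ℝ) + 1) * (if m + 1 = n then 2 / (2 * (n : ℝ) + 1) else 0) +
        m * (if m = n + 1 then 2 / (2 * (n : ℝ) + 1) else 0) := by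
  rw [← integralSymm_C_mul, ← mul_assoc, legendrePoly_recurrence, add_mul, mul_assoc, mul_assoc,
    map_add, integralSymm_C_mul, integralSymm_C_mul, integralSymm_legendrePoly_mul,
    integralSymm_legendrePoly_mul]
  cases m <;> simp

theorem integralSymm_X_mul_legendrePoly_mul_primitive_zero (m : ℕ) :
    (2 * (m : ℝ) + 1) *
        integralSymm (X * legendrePoly m * legendrePolyPrimitive 0) =
      if m = 0 then 2 / 3 else if m = 1 then 2 else if m = 2 then 4 / 3 else 0 := by
  rw [legendrePolyPrimitive, mul_add, map_add, mul_add, integralSymm_X_mul_legendrePoly_mul,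
    integralSymm_X_mul_legendrePoly_mul]
  rcases m with _ | _ | _ | m
  iterate 3 norm_num
  simp

theorem integralSymm_X_mul_legendrePoly_mul_primitive_succ (m n : ℕ) :
    (2 * (m : ℝ) + 1) * (2 * (n : ℝ) + 3) *
        integralSymm (X * legendrePoly m * legendrePolyPrimitive (n + 1)) =
      if m = n + 1 then -(2 * (2 * (n : ℝ) + 3) / ((2 * n + 1) * (2 * n + 5)))
      else if m = n + 3 then 2 * ((n : ℝ) + 3) / (2 * n + 5)
      else if m + 1 = n then -(2 * (n : ℝ) / (2 * n + 1)) else 0 := by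
  have h : (2 * (m : ℝ) + 1) * (2 * (n : ℝ) + 3) *
        integralSymm (X * legendrePoly m * legendrePolyPrimitive (n + 1)) =
      (2 * (m : ℝ) + 1) * integralSymm (X * legendrePoly m * legendrePoly (n + 2)) -
      (2 * (m : ℝ) + 1) * integralSymm (X * legendrePoly m * legendrePoly n) := by
    rw [legendrePolyPrimitive, mul_left_comm, integralSymm_C_mul, mul_sub, map_sub]
    field_simp
  rw [h, integralSymm_X_mul_legendrePoly_mul, integralSymm_X_mul_legendrePoly_mul]
  have e1 : 2 * (n : ℝ) + 1 ≠ 0 := by positivity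
  have e5 : 2 * (n : ℝ) + 5 ≠ 0 := by positivity
  have e5' : 2 * ((n : ℝ) + 2) + 1 = 2 * n + 5 := by ring
  by_cases h1 : m = n + 1
  · subst h1
    rw [if_pos rfl, if_neg (by omega), if_neg (by omega), if_pos rfl, if_pos rfl]
    push_cast
    rw [e5']
    field_simp
    ring
  by_cases h2 : m = n + 3
  · subst h2
    rw [if_neg (by omega), if_pos rfl, if_neg (by omega), if_neg (by omega), if_neg (by omega),
      if_pos rfl]
    push_cast
    rw [e5']
    ring
  by_cases h3 : m + 1 = n
  · subst h3
    rw [if_neg (by omega), if_neg (by omega), if_pos rfl, if_neg (by omega), if_neg (by omega),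
      if_neg (by omega), if_pos rfl]
    push_cast
    ring
  · rw [if_neg (by omega), if_neg (by omega), if_neg (by omega), if_neg (by omega), if_neg h1,
      if_neg h2, if_neg h3]
    ring

/-- Change of variables along the affine map of `[t, T]` onto `[-1, 1]`, with a variable upper
endpoint. -/
theorem integral_comp_affine {t T : ℝ} (ht : t < T) (f : ℝ → ℝ) (y : ℝ) :
    ∫ x in t..y, f ((2 * (x - t) - (T - t)) / (T - t)) =
      (T - t) / 2 * ∫ s in (-1 : ℝ)..((2 * (y - t) - (T - t)) / (T - t)), f s := by
  have hΔ : T - t ≠ 0 := (sub_pos.mpr ht).ne'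
  have h : ∀ x : ℝ, (2 * (x - t) - (T - t)) / (T - t) =
      2 / (T - t) * x + (-(2 * t) / (T - t) - 1) := fun x => by field_simp; ring
  have hl : 2 / (T - t) * t + (-(2 * t) / (T - t) - 1) = -1 := by ring
  simp only [h]
  rw [intervalIntegral.integral_comp_mul_add _ (div_ne_zero two_ne_zero hΔ), inv_div, smul_eq_mul,
    hl]

theorem integral_legendre_mul_primitive {t T : ℝ} (ht : t < T) (w : ℝ → ℝ) (a b : ℝ) (m n : ℕ) :
    ∫ y in t..T, w ((2 * (y - t) - (T - t)) / (T - t)) *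
        (a * legendreP m ((2 * (y - t) - (T - t)) / (T - t))) *
        ∫ x in t..y, b * legendreP n ((2 * (x - t) - (T - t)) / (T - t)) =
      a * b * ((T - t) ^ 2 / 4) * ∫ s in (-1 : ℝ)..1,
        w s * ((legendrePoly m).eval s * (legendrePolyPrimitive n).eval s) := by
  have hΔ : T - t ≠ 0 := (sub_pos.mpr ht).ne'
  have hr : (2 * (T - t) - (T - t)) / (T - t) = 1 := by field_simp; ring
  simp only [intervalIntegral.integral_const_mul, legendreP_eq_eval]
  simp only [integral_comp_affine ht (fun s => (legendrePoly n).eval s),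
    integral_eval_legendrePoly]
  rw [integral_comp_affine ht (fun s => w s * (a * (legendrePoly m).eval s) *
    (b * ((T - t) / 2 * (legendrePolyPrimitive n).eval s))), hr,
    ← intervalIntegral.integral_const_mul, ← intervalIntegral.integral_const_mul]
  congr 1
  funext s
  ring

end

/-- Fourier–Legendre coefficients of the kernel of the double stochastic integral `I₀₁`
with weight `(t−t₂)` on the outer variable:
`C⁰¹_{j₂j₁} = −(Δ/2)·C_{j₂j₁} − (Δ²/4)·A_{j₂j₁}` with the explicit matrix `A`. -/
theorem stmt_11 (t T : ℝ) (ht : t < T)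
    (φ : ℕ → ℝ → ℝ)
    (hφ : ∀ (n : ℕ) (x : ℝ), φ n x =
      Real.sqrt ((2 * (n : ℝ) + 1) / (T - t)) *
        legendreP n ((2 * (x - t) - (T - t)) / (T - t)))
    (C : ℕ → ℕ → ℝ)
    (hC : ∀ j2 j1 : ℕ, C j2 j1 = ∫ y in t..T, φ j2 y * ∫ x in t..y, φ j1 x)
    (C01 : ℕ → ℕ → ℝ)
    (hC01 : ∀ j2 j1 : ℕ,
      C01 j2 j1 = ∫ t2 in t..T, (t - t2) * φ j2 t2 * ∫ t1 in t..t2, φ j1 t1)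
    (A : ℕ → ℕ → ℝ)
    (hA10 : A 1 0 = 1 / Real.sqrt 3)
    (hAsup : ∀ i : ℕ, A (i + 2) i =
      ((i : ℝ) + 2) / ((2 * (i : ℝ) + 3) * Real.sqrt ((2 * (i : ℝ) + 1) * (2 * (i : ℝ) + 5))))
    (hAsub : ∀ i : ℕ, A i (i + 2) =
      -(((i : ℝ) + 1) / ((2 * (i : ℝ) + 3) * Real.sqrt ((2 * (i : ℝ) + 1) * (2 * (i : ℝ) + 5)))))
    (hAdiag : ∀ i : ℕ, A i i = -(1 / ((2 * (i : ℝ) - 1) * (2 * (i : ℝ) + 3))))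
    (hAzero : ∀ j2 j1 : ℕ, j2 ≠ j1 → j2 ≠ j1 + 2 → j1 ≠ j2 + 2 → ¬(j2 = 1 ∧ j1 = 0) →
      A j2 j1 = 0) :
    ∀ j2 j1 : ℕ,
      C01 j2 j1 = -((T - t) / 2) * C j2 j1 - ((T - t) ^ 2 / 4) * A j2 j1 := by
  intro m n
  have hΔ : 0 < T - t := sub_pos.mpr ht
  have key : C01 m n = -((T - t) / 2) * C m n -
      (T - t) ^ 2 / 4 * (√((2 * (m : ℝ) + 1) * (2 * (n : ℝ) + 1)) / 2 *
        integralSymm (Polynomial.X * legendrePoly m * legendrePolyPrimitive n)) := by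
    have hw : ∀ y, t - y = -((T - t) / 2) * (1 + (2 * (y - t) - (T - t)) / (T - t)) := fun y => by
      field_simp
      ring
    have h1 := integral_legendre_mul_primitive ht (fun _ => 1)
      (√((2 * (m : ℝ) + 1) / (T - t))) (√((2 * (n : ℝ) + 1) / (T - t))) m n
    have h2 := integral_legendre_mul_primitive ht (fun s => -((T - t) / 2) * (1 + s))
      (√((2 * (m : ℝ) + 1) / (T - t))) (√((2 * (n : ℝ) + 1) / (T - t))) m n
    have hs : √((2 * (m : ℝ) + 1) / (T - t)) * √((2 * (n : ℝ) + 1) / (T - t)) =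
        √((2 * (m : ℝ) + 1) * (2 * (n : ℝ) + 1)) / (T - t) := by
      rw [← Real.sqrt_mul (by positivity), div_mul_div_comm, Real.sqrt_div (by positivity),
        Real.sqrt_mul_self hΔ.le]
    have hI : ∫ s in (-1 : ℝ)..1, -((T - t) / 2) * (1 + s) *
          ((legendrePoly m).eval s * (legendrePolyPrimitive n).eval s) =
        -((T - t) / 2) * ((∫ s in (-1 : ℝ)..1,
          1 * ((legendrePoly m).eval s * (legendrePolyPrimitive n).eval s)) +
        integralSymm (Polynomial.X * legendrePoly m * legendrePolyPrimitive n)) := by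
      have h := map_add integralSymm (legendrePoly m * legendrePolyPrimitive n)
        (Polynomial.X * legendrePoly m * legendrePolyPrimitive n)
      simp only [integralSymm_apply, Polynomial.eval_add, Polynomial.eval_mul,
        Polynomial.eval_X] at h ⊢
      simp only [one_mul]
      rw [← h, ← intervalIntegral.integral_const_mul]
      congr 1
      funext s
      ring
    rw [hC, hC01]
    simp only [hφ, hw]
    simp only [one_mul] at h1 h2 hI
    rw [h1, h2, hI, hs]
    field_simp
    ring
  rw [key]
  congr 2
  rcases n with _ | n
  · have h := integralSymm_X_mul_legendrePoly_mul_primitive_zero m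
    have hm : 2 * (m : ℝ) + 1 ≠ 0 := by positivity
    by_cases h0 : m = 0
    · subst h0
      norm_num at h
      rw [hAdiag, h]
      norm_num
    by_cases h1 : m = 1
    · subst h1
      norm_num at h
      rw [hA10, eq_div_iff (by positivity)]
      norm_num
      linear_combination (1 / 2 : ℝ) * integralSymm (Polynomial.X * legendrePoly 1 *
        legendrePolyPrimitive 0) * Real.mul_self_sqrt (show (0 : ℝ) ≤ 3 by norm_num) + h / 2
    by_cases h2 : m = 2
    · subst h2
      norm_num at h
      rw [hAsup 0]
      norm_num
      field_simp
      norm_num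
      linear_combination 3 * h
    · rw [hAzero m 0 h0 h2 (by omega) (by omega)]
      simp only [h0, h1, h2, if_false, mul_eq_zero, hm, false_or] at h
      rw [h, mul_zero]
  · have h := integralSymm_X_mul_legendrePoly_mul_primitive_succ m n
    have hm : 2 * (m : ℝ) + 1 ≠ 0 := by positivity
    have hn : 2 * (n : ℝ) + 3 ≠ 0 := by positivity
    have e1 : 2 * (n : ℝ) + 1 ≠ 0 := by positivity
    have e5 : 2 * (n : ℝ) + 5 ≠ 0 := by positivity
    by_cases h1 : m = n + 1
    · subst h1
      rw [if_pos rfl] at h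
      push_cast at h ⊢
      rw [hAdiag, Real.sqrt_mul_self (by positivity)]
      push_cast
      have d1 : 2 * ((n : ℝ) + 1) - 1 = 2 * n + 1 := by ring
      have d3 : 2 * ((n : ℝ) + 1) + 1 = 2 * n + 3 := by ring
      have d5 : 2 * ((n : ℝ) + 1) + 3 = 2 * n + 5 := by ring
      rw [d3] at h
      rw [d1, d3, d5]
      apply mul_left_cancel₀ hn
      linear_combination h / 2
    by_cases h2 : m = n + 3
    · subst h2
      rw [if_neg (by omega), if_pos rfl] at h
      rw [hAsup (n + 1)]
      push_cast at h ⊢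
      have hS : (2 * ((n : ℝ) + 3) + 1) * (2 * (n + 1) + 1) =
        (2 * ((n : ℝ) + 1) + 1) * (2 * (n + 1) + 5) := by ring
      rw [hS]
      have hP := Real.mul_self_sqrt
        (show 0 ≤ (2 * ((n : ℝ) + 1) + 1) * (2 * (n + 1) + 5) by positivity)
      rw [eq_div_iff (by positivity)]
      field_simp at h
      apply mul_left_cancel₀ e5
      linear_combination (2 * (n : ℝ) + 5) / 2 *
        integralSymm (Polynomial.X * legendrePoly (n + 3) * legendrePolyPrimitive (n + 1)) *
        (2 * ((n : ℝ) + 1) + 3) * hP + (2 * (n : ℝ) + 5) / 2 * h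
    by_cases h3 : m + 1 = n
    · subst h3
      rw [if_neg (by omega), if_neg (by omega), if_pos rfl] at h
      rw [hAsub m]
      push_cast at h ⊢
      have hS : (2 * (m : ℝ) + 1) * (2 * (m + 1 + 1) + 1) =
        (2 * (m : ℝ) + 1) * (2 * m + 5) := by ring
      rw [hS]
      have hP := Real.mul_self_sqrt (show 0 ≤ (2 * (m : ℝ) + 1) * (2 * m + 5) by positivity)
      rw [← neg_div, eq_div_iff (by positivity)]
      have d3 : 2 * ((m : ℝ) + 1) + 1 = 2 * m + 3 := by ring
      have d3' : 2 * (m : ℝ) + 3 ≠ 0 := by positivity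
      rw [d3, ← neg_div, eq_div_iff d3'] at h
      linear_combination integralSymm (Polynomial.X * legendrePoly m *
        legendrePolyPrimitive (m + 1 + 1)) * (2 * (m : ℝ) + 3) / 2 * hP + h / 2
    · rw [hAzero m (n + 1) h1 h2 (by omega) (by omega)]
      rw [if_neg h1, if_neg h2, if_neg h3] at h
      rw [(mul_eq_zero.mp h).resolve_left (mul_ne_zero hm hn), mul_zero]
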